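/- If x₀ lies on the boundary (frontier) of R(N), then there exists a nonzero vector d ∈ ℝ^n with ⟨d, x₀⟩ = ∑_{i=0}^{N-1} ∑_{j=1}^{r} |⟨d, A^i B e_j⟩| such that every input sequence (z_0, …, z_{N-1}) in the solution space U_N(x₀) satisfies z_{i,j} = sgn(⟨d, A^i B e_j⟩) for every pair (i, j) with ⟨d, A^i B e_j⟩ ≠ 0, where e_j is the j-th standard basis vector of ℝ^r and z_{i,j} is the j-th component of z_i. -/

import Mathlib

open Matrix

/-- The controllability (reachability) region after `N` steps of the linear discrete-time
system `x_{k+1} = A x_k + B u_k` under the unit input constraint `‖u_k‖_∞ ≤ 1`. -/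
def reachRegion {n r : ℕ} (A : Matrix (Fin n) (Fin n) ℝ) (B : Matrix (Fin n) (Fin r) ℝ)
    (N : ℕ) : Set (Fin n → ℝ) :=
  {x | ∃ z : Fin N → Fin r → ℝ, (∀ k, ‖z k‖ ≤ 1) ∧
    x = ∑ k : Fin N, (A ^ (k : ℕ)) *ᵥ (B *ᵥ z k)}

/-- The solution space `U_N(x₀)` of admissible input sequences of length `N` steering the
origin to `x₀`. -/
def solutionSpace {n r : ℕ} (A : Matrix (Fin n) (Fin n) ℝ) (B : Matrix (Fin n) (Fin r) ℝ)
    (N : ℕ) (x₀ : Fin n → ℝ) : Set (Fin N → Fin r → ℝ) :=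
  {z | (∑ i : Fin N, (A ^ (i : ℕ)) *ᵥ (B *ᵥ z i)) = x₀ ∧ ∀ i, ‖z i‖ ≤ 1}

/-- A convex set in a finite-dimensional space has a supporting hyperplane at each of its points
that is not interior. -/
theorem Convex.exists_ne_zero_forall_le_of_notMem_interior {V : Type*} [NormedAddCommGroup V]
    [NormedSpace ℝ V] [FiniteDimensional ℝ V] {s : Set V} (hs : Convex ℝ s) {x : V}
    (hxs : x ∈ s) (hx : x ∉ interior s) :
    ∃ f : Module.Dual ℝ V, f ≠ 0 ∧ ∀ y ∈ s, f y ≤ f x := by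
  by_cases hint : (interior s).Nonempty
  · obtain ⟨f, hf, hle⟩ := geometric_hahn_banach_of_nonempty_interior_point hs hx hint
    exact ⟨f, fun h => hf (ContinuousLinearMap.coe_injective h), hle⟩
  · rw [hs.interior_nonempty_iff_affineSpan_eq_top,
      ← AffineSubspace.direction_eq_top_iff_of_nonempty ⟨x, subset_affineSpan ℝ s hxs⟩] at hint
    obtain ⟨f, hf, hker⟩ := Submodule.exists_le_ker_of_lt_top _ (lt_top_iff_ne_top.2 hint)
    refine ⟨f, hf, fun y hy => ?_⟩
    have hyx : f (y - x) = 0 := hker <| AffineSubspace.vsub_mem_direction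
      (subset_affineSpan ℝ s hy) (subset_affineSpan ℝ s hxs)
    rw [map_sub, sub_eq_zero] at hyx
    exact hyx.le

/-- The linear map sending an input sequence `z` to the state `∑ AⁱB zᵢ`. -/
def reachMap {n r : ℕ} (A : Matrix (Fin n) (Fin n) ℝ) (B : Matrix (Fin n) (Fin r) ℝ) (N : ℕ) :
    (Fin N → Fin r → ℝ) →ₗ[ℝ] Fin n → ℝ :=
  ∑ k : Fin N, (A ^ (k : ℕ)).mulVecLin ∘ₗ B.mulVecLin ∘ₗ LinearMap.proj k

theorem reachMap_apply {n r : ℕ} (A : Matrix (Fin n) (Fin n) ℝ) (B : Matrix (Fin n) (Fin r) ℝ)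
    (N : ℕ) (z : Fin N → Fin r → ℝ) :
    reachMap A B N z = ∑ k : Fin N, (A ^ (k : ℕ)) *ᵥ (B *ᵥ z k) := by
  simp [reachMap]

theorem reachRegion_eq_image {n r : ℕ} (A : Matrix (Fin n) (Fin n) ℝ)
    (B : Matrix (Fin n) (Fin r) ℝ) (N : ℕ) :
    reachRegion A B N = reachMap A B N '' Metric.closedBall 0 1 := by
  ext x
  simp only [reachRegion, Set.mem_ofPred_eq, Set.mem_image, mem_closedBall_zero_iff,
    pi_norm_le_iff_of_nonneg zero_le_one, reachMap_apply, eq_comm]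

theorem convex_reachRegion {n r : ℕ} (A : Matrix (Fin n) (Fin n) ℝ)
    (B : Matrix (Fin n) (Fin r) ℝ) (N : ℕ) : Convex ℝ (reachRegion A B N) := by
  rw [reachRegion_eq_image]
  exact (convex_closedBall 0 1).linear_image _

theorem isCompact_reachRegion {n r : ℕ} (A : Matrix (Fin n) (Fin n) ℝ)
    (B : Matrix (Fin n) (Fin r) ℝ) (N : ℕ) : IsCompact (reachRegion A B N) := by
  rw [reachRegion_eq_image]
  exact (isCompact_closedBall 0 1).image (reachMap A B N).continuous_of_finiteDimensional

theorem dotProduct_sum_mulVec_eq {n r : ℕ} (A : Matrix (Fin n) (Fin n) ℝ)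
    (B : Matrix (Fin n) (Fin r) ℝ) {N : ℕ} (d : Fin n → ℝ) (z : Fin N → Fin r → ℝ) :
    d ⬝ᵥ ∑ i : Fin N, (A ^ (i : ℕ)) *ᵥ (B *ᵥ z i) =
      ∑ i : Fin N, ∑ j : Fin r, (d ⬝ᵥ ((A ^ (i : ℕ)) *ᵥ (B *ᵥ Pi.single j 1))) * z i j := by
  rw [dotProduct_sum]
  refine Finset.sum_congr rfl fun i _ => ?_
  simp only [Matrix.mulVec_mulVec, Matrix.dotProduct_mulVec, dotProduct_single_one]
  rfl

theorem Real.mul_sign_eq_abs (c : ℝ) : c * Real.sign c = |c| := by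
  rcases lt_trichotomy c 0 with h | rfl | h
  · simp [Real.sign_of_neg h, abs_of_neg h]
  · simp
  · simp [Real.sign_of_pos h, abs_of_pos h]

theorem Real.abs_sign_le_one (c : ℝ) : |Real.sign c| ≤ 1 := by
  rcases Real.sign_apply_eq c with h | h | h <;> simp [h]

theorem Real.mul_le_abs_of_abs_le_one {c t : ℝ} (ht : |t| ≤ 1) : c * t ≤ |c| :=
  (le_abs_self _).trans <| by
    rw [abs_mul]
    exact mul_le_of_le_one_right (abs_nonneg c) ht

/-- If `x₀` lies on the frontier of `R(N)`, then there is a nonzero `d ∈ ℝ^n` with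
`⟨d, x₀⟩ = ∑_{i<N} ∑_{j<r} |⟨d, AⁱB eⱼ⟩|` such that every admissible input sequence in
`U_N(x₀)` satisfies `z_{i,j} = sgn(⟨d, AⁱB eⱼ⟩)` whenever `⟨d, AⁱB eⱼ⟩ ≠ 0`. -/
theorem frontier_point_forces_inputs {n r : ℕ}
    (A : Matrix (Fin n) (Fin n) ℝ) (B : Matrix (Fin n) (Fin r) ℝ)
    (N : ℕ) (hN : 0 < N) (x₀ : Fin n → ℝ)
    (hx : x₀ ∈ frontier (reachRegion A B N)) :
    ∃ d : Fin n → ℝ, d ≠ 0 ∧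
      d ⬝ᵥ x₀ = ∑ i : Fin N, ∑ j : Fin r, |d ⬝ᵥ ((A ^ (i : ℕ)) *ᵥ (B *ᵥ Pi.single j 1))| ∧
      ∀ z ∈ solutionSpace A B N x₀, ∀ (i : Fin N) (j : Fin r),
        d ⬝ᵥ ((A ^ (i : ℕ)) *ᵥ (B *ᵥ Pi.single j 1)) ≠ 0 →
        z i j = Real.sign (d ⬝ᵥ ((A ^ (i : ℕ)) *ᵥ (B *ᵥ Pi.single j 1))) := by
  have hmem : x₀ ∈ reachRegion A B N :=
    (isCompact_reachRegion A B N).isClosed.frontier_subset hx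
  obtain ⟨f, hf, hle⟩ :=
    (convex_reachRegion A B N).exists_ne_zero_forall_le_of_notMem_interior hmem hx.2
  obtain ⟨d, rfl⟩ := (dotProductEquiv ℝ (Fin n)).surjective f
  simp only [dotProductEquiv_apply_apply] at hle
  have habs : ∀ z : Fin N → Fin r → ℝ, (∀ i, ‖z i‖ ≤ 1) → ∀ i j, |z i j| ≤ 1 :=
    fun z hz i j => (norm_le_pi_norm (z i) j).trans (hz i)
  have heq : d ⬝ᵥ x₀ =
      ∑ i : Fin N, ∑ j : Fin r, |d ⬝ᵥ ((A ^ (i : ℕ)) *ᵥ (B *ᵥ Pi.single j 1))| := by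
    apply le_antisymm
    · obtain ⟨z, hz, rfl⟩ := hmem
      rw [dotProduct_sum_mulVec_eq]
      exact Finset.sum_le_sum fun i _ => Finset.sum_le_sum fun j _ =>
        Real.mul_le_abs_of_abs_le_one (habs z hz i j)
    · have h := hle _ ⟨fun i j => Real.sign (d ⬝ᵥ ((A ^ (i : ℕ)) *ᵥ (B *ᵥ Pi.single j 1))),
        fun i => (pi_norm_le_iff_of_nonneg zero_le_one).2 fun j => Real.abs_sign_le_one _, rfl⟩
      rw [dotProduct_sum_mulVec_eq] at h
      simpa only [Real.mul_sign_eq_abs] using h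
  refine ⟨d, fun h => hf (by rw [h, map_zero]), heq, ?_⟩
  rintro z ⟨rfl, hz⟩ i j hc
  have hterm : ∀ (i : Fin N) (j : Fin r),
      (d ⬝ᵥ ((A ^ (i : ℕ)) *ᵥ (B *ᵥ Pi.single j 1))) * z i j ≤
      |d ⬝ᵥ ((A ^ (i : ℕ)) *ᵥ (B *ᵥ Pi.single j 1))| :=
    fun i j => Real.mul_le_abs_of_abs_le_one (habs z hz i j)
  rw [dotProduct_sum_mulVec_eq, Finset.sum_eq_sum_iff_of_le
    fun i _ => Finset.sum_le_sum fun j _ => hterm i j] at heq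
  have hij := (Finset.sum_eq_sum_iff_of_le fun j _ => hterm i j).1
    (heq i (Finset.mem_univ i)) j (Finset.mem_univ j)
  rw [← Real.mul_sign_eq_abs] at hij
  exact mul_left_cancel₀ hc hij
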